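/- Let η : [0,1] → ℝ be continuous and strictly decreasing with η(0) = 1 and η(1) = 0, and set v := ∫₀¹ η(ν) dν. Let χ ≥ 0 and let F be a CDF whose associated probability measure is not a point mass (F is not of the form 1_{[a,∞)} for any a ∈ ℝ) and satisfies ∫ |x|^{1+χ} dF(x) < ∞. Then ∫₀¹ (η(ν) − v) · sgn(F⁻¹(ν)) · |F⁻¹(ν)|^{1+χ} dν < 0. -/

import Mathlib

open MeasureTheory Filter Set ENNReal NNReal

noncomputable section

/-- sign: `1` if `0 ≤ y`, `-1` otherwise. -/
def sgn (y : ℝ) : ℝ := if 0 ≤ y then 1 else -1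

/-- `F` is a (proper) cumulative distribution function. -/
structure IsCDF (F : ℝ → ℝ) : Prop where
  mono : Monotone F
  right_continuous : ∀ x, ContinuousWithinAt F (Set.Ici x) x
  tendsto_atBot : Filter.Tendsto F Filter.atBot (nhds 0)
  tendsto_atTop : Filter.Tendsto F Filter.atTop (nhds 1)

open Classical in
/-- The Lebesgue–Stieltjes measure associated with `F` (junk value `0` if `F` is not
monotone right-continuous). -/
def cdfMeasure (F : ℝ → ℝ) : Measure ℝ :=
  if h : Monotone F ∧ ∀ x, ContinuousWithinAt F (Set.Ici x) x then
    StieltjesFunction.measure ⟨F, h.1, h.2⟩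
  else 0

/-- Quantile (generalized inverse) of `F`. -/
def quantile (F : ℝ → ℝ) (ν : ℝ) : ℝ := sInf {y | ν ≤ F y}

end

theorem strictMono_sgn_mul_abs_rpow {p : ℝ} (hp : 0 < p) :
    StrictMono fun y : ℝ => sgn y * |y| ^ p := by
  intro a b hab
  simp only [sgn]
  rcases le_or_gt 0 a with ha | ha
  · have hb : 0 ≤ b := ha.trans hab.le
    simpa [ha, hb, abs_of_nonneg] using Real.rpow_lt_rpow ha hab hp
  · have ha' : 0 < |a| ^ p := Real.rpow_pos_of_pos (abs_pos.2 ha.ne) p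
    rcases le_or_gt 0 b with hb | hb
    · have hb' : 0 ≤ |b| ^ p := by positivity
      simp only [if_neg ha.not_ge, if_pos hb]
      linarith
    · have h : |b| ^ p < |a| ^ p := by
        refine Real.rpow_lt_rpow (abs_nonneg b) ?_ hp
        rw [abs_of_neg ha, abs_of_neg hb]
        linarith
      simp only [if_neg ha.not_ge, if_neg hb.not_ge]
      linarith

theorem measurable_sgn : Measurable sgn :=
  Measurable.ite measurableSet_Ici measurable_const measurable_const

theorem IsCDF.nonneg {F : ℝ → ℝ} (hF : IsCDF F) (x : ℝ) : 0 ≤ F x :=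
  hF.mono.le_of_tendsto hF.tendsto_atBot x

theorem IsCDF.le_one {F : ℝ → ℝ} (hF : IsCDF F) (x : ℝ) : F x ≤ 1 :=
  hF.mono.ge_of_tendsto hF.tendsto_atTop x

theorem IsCDF.quantile_le_iff {F : ℝ → ℝ} (hF : IsCDF F) {ν : ℝ} (hν : ν ∈ Ioo (0 : ℝ) 1)
    (x : ℝ) : quantile F ν ≤ x ↔ ν ≤ F x := by
  have hne : {y | ν ≤ F y}.Nonempty := by
    obtain ⟨y, hy⟩ := (hF.tendsto_atTop.eventually (lt_mem_nhds hν.2)).exists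
    exact ⟨y, hy.le⟩
  have hbdd : BddBelow {y | ν ≤ F y} := by
    obtain ⟨z, hz⟩ := (hF.tendsto_atBot.eventually (gt_mem_nhds hν.1)).exists
    exact ⟨z, fun y hy => le_of_lt (hF.mono.reflect_lt (hz.trans_le hy))⟩
  refine ⟨fun h => ?_, fun h => csInf_le hbdd h⟩
  have hq : ν ≤ F (quantile F ν) := by
    have ht : Tendsto F (nhdsWithin (quantile F ν) (Ioi (quantile F ν)))
        (nhds (F (quantile F ν))) :=
      (hF.right_continuous _).mono_left (nhdsWithin_mono _ Ioi_subset_Ici_self)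
    refine ge_of_tendsto ht ?_
    filter_upwards [self_mem_nhdsWithin] with y hy
    obtain ⟨z, hz, hzy⟩ := exists_lt_of_csInf_lt hne hy
    exact le_trans hz (hF.mono hzy.le)
  exact hq.trans (hF.mono h)

theorem IsCDF.monotoneOn_quantile {F : ℝ → ℝ} (hF : IsCDF F) :
    MonotoneOn (quantile F) (Ioo (0 : ℝ) 1) := fun _ ha _ hb hab =>
  (hF.quantile_le_iff ha _).2 (hab.trans ((hF.quantile_le_iff hb _).1 le_rfl))

theorem IsCDF.aemeasurable_quantile {F : ℝ → ℝ} (hF : IsCDF F) :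
    AEMeasurable (quantile F) (volume.restrict (Ioo (0 : ℝ) 1)) :=
  aemeasurable_restrict_of_monotoneOn measurableSet_Ioo hF.monotoneOn_quantile

theorem IsCDF.map_quantile {F : ℝ → ℝ} (hF : IsCDF F) :
    (volume.restrict (Ioo (0 : ℝ) 1)).map (quantile F) = cdfMeasure F := by
  have : IsFiniteMeasure (volume.restrict (Ioo (0 : ℝ) 1)) := ⟨by simp⟩
  refine Measure.ext_of_Iic _ _ fun x => ?_
  rw [cdfMeasure, dif_pos ⟨hF.mono, hF.right_continuous⟩,
    StieltjesFunction.measure_Iic _ hF.tendsto_atBot,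
    Measure.map_apply_of_aemeasurable hF.aemeasurable_quantile measurableSet_Iic,
    Measure.restrict_apply₀' measurableSet_Ioo.nullMeasurableSet]
  have hset : quantile F ⁻¹' Iic x ∩ Ioo 0 1 = Iic (F x) ∩ Ioo 0 1 := by
    ext ν
    simp only [mem_inter_iff, mem_preimage, mem_Iic]
    exact and_congr_left fun hν => hF.quantile_le_iff hν x
  rw [hset]
  change _ = ENNReal.ofReal (F x - 0)
  refine le_antisymm ?_ ?_
  · calc volume (Iic (F x) ∩ Ioo 0 1) ≤ volume (Ioc 0 (F x)) :=
          measure_mono fun ν hν => ⟨hν.2.1, hν.1⟩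
      _ = _ := Real.volume_Ioc
  · calc ENNReal.ofReal (F x - 0) = volume (Ioo 0 (F x)) := Real.volume_Ioo.symm
      _ ≤ volume (Iic (F x) ∩ Ioo 0 1) := measure_mono fun ν hν =>
          ⟨hν.2.le, hν.1, hν.2.trans_le (hF.le_one x)⟩

theorem IsCDF.integrableOn_sgn_mul_abs_quantile_rpow {F : ℝ → ℝ} (hF : IsCDF F) {p : ℝ}
    (hmom : Integrable (fun x => |x| ^ p) (cdfMeasure F)) :
    IntegrableOn (fun ν => sgn (quantile F ν) * |quantile F ν| ^ p) (Ioo (0 : ℝ) 1) := by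
  have h : IntegrableOn (fun ν => |quantile F ν| ^ p) (Ioo (0 : ℝ) 1) := by
    rw [← hF.map_quantile] at hmom
    exact hmom.comp_aemeasurable hF.aemeasurable_quantile
  refine Integrable.bdd_mul (c := 1) h
    (measurable_sgn.comp_aemeasurable hF.aemeasurable_quantile).aestronglyMeasurable ?_
  refine ae_of_all _ fun ν => ?_
  unfold sgn
  split_ifs <;> simp

theorem IsCDF.eq_ite_of_quantile_eq {F : ℝ → ℝ} (hF : IsCDF F) {a : ℝ}
    (ha : ∀ ν ∈ Ioo (0 : ℝ) 1, quantile F ν = a) (x : ℝ) : F x = if a ≤ x then 1 else 0 := by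
  split_ifs with h
  · refine le_antisymm (hF.le_one x) (le_of_forall_lt_imp_le_of_dense fun ν hν => ?_)
    rcases le_or_gt ν 0 with h0 | h0
    · exact h0.trans (hF.nonneg x)
    · exact (hF.quantile_le_iff ⟨h0, hν⟩ x).1 ((ha ν ⟨h0, hν⟩).trans_le h)
  · refine le_antisymm (le_of_not_gt fun hpos => h ?_) (hF.nonneg x)
    have hmem : F x / 2 ∈ Ioo (0 : ℝ) 1 := ⟨by linarith, by linarith [hF.le_one x]⟩
    rw [← ha _ hmem]
    exact (hF.quantile_le_iff hmem x).2 (by linarith)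

/-- The mean over `(0, 1)` of a continuous strictly decreasing function is attained inside. -/
theorem exists_eq_setIntegral_Ioo {η : ℝ → ℝ} (hc : ContinuousOn η (Icc 0 1))
    (ha : StrictAntiOn η (Icc 0 1)) : ∃ c ∈ Ioo (0 : ℝ) 1, η c = ∫ ν in Ioo (0 : ℝ) 1, η ν := by
  have h0 : (0 : ℝ) ∈ Icc (0 : ℝ) 1 := by simp
  have h1 : (1 : ℝ) ∈ Icc (0 : ℝ) 1 := by simp
  have hlt : ∀ c ∈ Ioo (0 : ℝ) 1, η 1 < η c ∧ η c < η 0 := fun c hc =>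
    ⟨ha (Ioo_subset_Icc_self hc) h1 hc.2, ha h0 (Ioo_subset_Icc_self hc) hc.1⟩
  have hhalf : (1 / 2 : ℝ) ∈ Icc (0 : ℝ) 1 := by norm_num
  have hhalf' := hlt (1 / 2) (by norm_num)
  have key : ∫ ν in Ioo (0 : ℝ) 1, η ν = ∫ ν in (0 : ℝ)..1, η ν := by
    rw [intervalIntegral.integral_of_le zero_le_one, integral_Ioc_eq_integral_Ioo]
  have hlo : η 1 < ∫ ν in (0 : ℝ)..1, η ν := by
    have := intervalIntegral.integral_lt_integral_of_continuousOn_of_le_of_exists_lt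
      (a := 0) (b := 1) (f := fun _ => η 1) (g := η) one_pos continuousOn_const hc
      (fun x hx => ha.antitoneOn (Ioc_subset_Icc_self hx) h1 hx.2) ⟨_, hhalf, hhalf'.1⟩
    simpa using this
  have hhi : ∫ ν in (0 : ℝ)..1, η ν < η 0 := by
    have := intervalIntegral.integral_lt_integral_of_continuousOn_of_le_of_exists_lt
      (a := 0) (b := 1) (f := η) (g := fun _ => η 0) one_pos hc continuousOn_const
      (fun x hx => ha.antitoneOn h0 (Ioc_subset_Icc_self hx) hx.1.le) ⟨_, hhalf, hhalf'.2⟩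
    simpa using this
  rw [key]
  exact intermediate_value_Ioo' zero_le_one hc ⟨hlo, hhi⟩

/-- A strict form of Chebyshev's integral inequality on `(0, 1)`. -/
theorem setIntegral_sub_mul_neg_of_strictAntiOn_of_monotoneOn {η g : ℝ → ℝ}
    (hc : ContinuousOn η (Icc 0 1)) (ha : StrictAntiOn η (Icc 0 1))
    (hg : MonotoneOn g (Ioo 0 1)) (hgi : IntegrableOn g (Ioo 0 1))
    (hne : ∀ c ∈ Ioo (0 : ℝ) 1, ∃ ν ∈ Ioo (0 : ℝ) 1, g ν ≠ g c) :
    ∫ ν in Ioo (0 : ℝ) 1, (η ν - ∫ ν' in Ioo (0 : ℝ) 1, η ν') * g ν < 0 := by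
  obtain ⟨c, hcm, hcv⟩ := exists_eq_setIntegral_Ioo hc ha
  have hηi : IntegrableOn η (Ioo 0 1) :=
    (hc.integrableOn_Icc).mono_set Ioo_subset_Icc_self
  have hconst : ∀ k : ℝ, IntegrableOn (fun _ => k) (Ioo (0 : ℝ) 1) := fun k =>
    integrableOn_const (by simp)
  have hmean : ∫ ν in Ioo (0 : ℝ) 1, (η ν - η c) = 0 := by
    rw [integral_sub hηi (hconst _), ← hcv]
    simp
  rw [← hcv]
  have hηg : ∀ f : ℝ → ℝ, IntegrableOn f (Ioo 0 1) →
      IntegrableOn (fun ν => (η ν - η c) * f ν) (Ioo 0 1) := fun f hf => by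
    refine Integrable.bdd_mul (c := η 0 - η 1) hf (hηi.sub (hconst _)).aestronglyMeasurable ?_
    filter_upwards [ae_restrict_mem measurableSet_Ioo] with ν hν
    have h0 : (0 : ℝ) ∈ Icc (0 : ℝ) 1 := by simp
    have h1 : (1 : ℝ) ∈ Icc (0 : ℝ) 1 := by simp
    have hb : ∀ ν ∈ Ioo (0 : ℝ) 1, η 1 ≤ η ν ∧ η ν ≤ η 0 := fun ν hν =>
      ⟨ha.antitoneOn (Ioo_subset_Icc_self hν) h1 hν.2.le,
        ha.antitoneOn h0 (Ioo_subset_Icc_self hν) hν.1.le⟩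
    rw [Real.norm_eq_abs, abs_le]
    constructor <;> linarith [hb ν hν, hb c hcm]
  have hstep : ∫ ν in Ioo (0 : ℝ) 1, (η ν - η c) * g ν
      = -∫ ν in Ioo (0 : ℝ) 1, (η ν - η c) * (g c - g ν) := by
    have hsplit : ∫ ν in Ioo (0 : ℝ) 1, (η ν - η c) * (g c - g ν)
        = (∫ ν in Ioo (0 : ℝ) 1, (η ν - η c) * g c)
          - ∫ ν in Ioo (0 : ℝ) 1, (η ν - η c) * g ν := by
      rw [← integral_sub (hηg _ (hconst _)) (hηg _ hgi)]
      simp only [mul_sub]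
    rw [hsplit, integral_mul_const, hmean]
    ring
  have hnn : 0 ≤ᵐ[volume.restrict (Ioo (0 : ℝ) 1)] fun ν => (η ν - η c) * (g c - g ν) := by
    filter_upwards [ae_restrict_mem measurableSet_Ioo] with ν hν
    have hνI := Ioo_subset_Icc_self hν
    have hcI := Ioo_subset_Icc_self hcm
    rcases le_total ν c with h | h
    · exact mul_nonneg (sub_nonneg.2 (ha.antitoneOn hνI hcI h)) (sub_nonneg.2 (hg hν hcm h))
    · exact mul_nonneg_of_nonpos_of_nonpos (sub_nonpos.2 (ha.antitoneOn hcI hνI h))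
        (sub_nonpos.2 (hg hcm hν h))
  rw [hstep, neg_lt_zero,
    setIntegral_pos_iff_support_of_nonneg_ae hnn (hηg _ ((hconst _).sub hgi))]
  obtain ⟨d, hd, hdc⟩ := hne c hcm
  rcases lt_trichotomy d c with h | h | h
  · refine lt_of_lt_of_le (b := volume (Ioo 0 d)) (by simpa using hd.1) (measure_mono ?_)
    intro ν hν
    have hνm : ν ∈ Ioo (0 : ℝ) 1 := ⟨hν.1, hν.2.trans hd.2⟩
    have h₁ := ha (Ioo_subset_Icc_self hνm) (Ioo_subset_Icc_self hcm) (hν.2.trans h)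
    have h₂ := (hg hνm hd hν.2.le).trans_lt (lt_of_le_of_ne (hg hd hcm h.le) hdc)
    exact ⟨(mul_pos (sub_pos.2 h₁) (sub_pos.2 h₂)).ne', hνm⟩
  · exact absurd (congrArg g h) hdc
  · refine lt_of_lt_of_le (b := volume (Ioo d 1)) (by simpa using hd.2) (measure_mono ?_)
    intro ν hν
    have hνm : ν ∈ Ioo (0 : ℝ) 1 := ⟨hd.1.trans hν.1, hν.2⟩
    have h₁ := ha (Ioo_subset_Icc_self hcm) (Ioo_subset_Icc_self hνm) (h.trans hν.1)
    have h₂ := (lt_of_le_of_ne (hg hcm hd h.le) hdc.symm).trans_le (hg hd hνm hν.1.le)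
    exact ⟨(mul_pos_of_neg_of_neg (sub_neg.2 h₁) (sub_neg.2 h₂)).ne', hνm⟩

theorem quantile_drift_integral_neg
    (η : ℝ → ℝ)
    (hη_cont : ContinuousOn η (Set.Icc 0 1))
    (hη_anti : StrictAntiOn η (Set.Icc 0 1))
    (hη0 : η 0 = 1) (hη1 : η 1 = 0)
    (χ : ℝ) (hχ : 0 ≤ χ)
    (F : ℝ → ℝ) (hF : IsCDF F)
    (hF_not_pointmass : ¬ ∃ a : ℝ, ∀ x : ℝ, F x = if a ≤ x then 1 else 0)
    (hF_mom : MeasureTheory.Integrable (fun x => |x| ^ (1 + χ)) (cdfMeasure F)) :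
    (∫ ν in Set.Ioo (0:ℝ) 1,
        (η ν - ∫ ν' in Set.Ioo (0:ℝ) 1, η ν') * sgn (quantile F ν) * |quantile F ν| ^ (1 + χ))
      < 0 := by
  have hmono := strictMono_sgn_mul_abs_rpow (p := 1 + χ) (by linarith)
  simp only [mul_assoc]
  refine setIntegral_sub_mul_neg_of_strictAntiOn_of_monotoneOn hη_cont hη_anti
    (hmono.monotone.comp_monotoneOn hF.monotoneOn_quantile)
    (hF.integrableOn_sgn_mul_abs_quantile_rpow hF_mom) fun c _ => ?_
  by_contra! h
  exact hF_not_pointmass ⟨quantile F c,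
    hF.eq_ite_of_quantile_eq fun ν hν => hmono.injective (h ν hν)⟩
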